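/- Row-by-row differentiation of the Berezinian: let δ : Λ → Λ be an ℝ-linear derivation preserving the grading (δ(Λ₀) ⊆ Λ₀ and δ(Λ₁) ⊆ Λ₁), applied entrywise to rows of matrices. Let A be an even supermatrix of format p|q with both det A₀₀ and det A₁₁ invertible. Then δ(Ber A) = Σ_{i=1}^{p} Ber( A⟨row i ← δ(row i of A)⟩ ) − (Ber A)² · Σ_{i=p+1}^{p+q} Ber*( A⟨row i ← δ(row i of A)⟩ ). -/

import Mathlib

set_option synthInstance.maxHeartbeats 1000000
set_option maxHeartbeats 1000000
noncomputable section

open Matrix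

variable {V : Type} [AddCommGroup V] [Module ℝ V]

/-- The even part `Λ₀` of the exterior algebra `Λ = ExteriorAlgebra ℝ V`. -/
def Λ₀ (V : Type) [AddCommGroup V] [Module ℝ V] :
    Submodule ℝ (ExteriorAlgebra ℝ V) :=
  CliffordAlgebra.evenOdd (0 : QuadraticForm ℝ V) 0

/-- The odd part `Λ₁` of the exterior algebra `Λ = ExteriorAlgebra ℝ V`. -/
def Λ₁ (V : Type) [AddCommGroup V] [Module ℝ V] :
    Submodule ℝ (ExteriorAlgebra ℝ V) :=
  CliffordAlgebra.evenOdd (0 : QuadraticForm ℝ V) 1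

/-- The determinant of a square matrix over `Λ` given by the Leibniz sum, with the
products taken in the natural order of the indices.  For the matrices appearing below
(at most one row or column of odd entries, all other entries even hence central) this
is unambiguous. -/
def ncdet {n : ℕ} (M : Matrix (Fin n) (Fin n) (ExteriorAlgebra ℝ V)) :
    ExteriorAlgebra ℝ V :=
  ∑ σ : Equiv.Perm (Fin n),
    (Equiv.Perm.sign σ : ℤ) • (List.ofFn fun i => M (σ i) i).prod

/-- The Berezinian `Ber A = det(A₀₀ − A₀₁A₁₁⁻¹A₁₀)·(det A₁₁)⁻¹` of a supermatrix of
format `p|q` (rows/columns indexed by `Fin p ⊕ Fin q`, the `inl` indices being even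
and the `inr` ones odd). -/
def Ber {p q : ℕ}
    (A : Matrix (Fin p ⊕ Fin q) (Fin p ⊕ Fin q) (ExteriorAlgebra ℝ V)) :
    ExteriorAlgebra ℝ V :=
  ncdet (A.toBlocks₁₁ - A.toBlocks₁₂ * Ring.inverse A.toBlocks₂₂ * A.toBlocks₂₁)
    * Ring.inverse (ncdet A.toBlocks₂₂)

/-- The inverse Berezinian `Ber* A = det(A₁₁ − A₁₀A₀₀⁻¹A₀₁)·(det A₀₀)⁻¹`. -/
def BerStar {p q : ℕ}
    (A : Matrix (Fin p ⊕ Fin q) (Fin p ⊕ Fin q) (ExteriorAlgebra ℝ V)) :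
    ExteriorAlgebra ℝ V :=
  ncdet (A.toBlocks₂₂ - A.toBlocks₂₁ * Ring.inverse A.toBlocks₁₁ * A.toBlocks₁₂)
    * Ring.inverse (ncdet A.toBlocks₁₁)

/-- The parity of an index of a supermatrix of format `p|q`. -/
def parIdx {p q : ℕ} : Fin p ⊕ Fin q → ZMod 2 :=
  Sum.elim (fun _ => 0) (fun _ => 1)

/-- `A` is an even supermatrix of format `p|q`: the entry `A i j` is even when the
indices `i`, `j` have equal parities and odd otherwise. -/
def IsEvenSupermatrix {p q : ℕ}
    (A : Matrix (Fin p ⊕ Fin q) (Fin p ⊕ Fin q) (ExteriorAlgebra ℝ V)) : Prop :=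
  ∀ i j, A i j ∈ CliffordAlgebra.evenOdd (0 : QuadraticForm ℝ V) (parIdx i + parIdx j)

/-- A row (or column) vector `u` has parity pattern `par`: the entry at position `j`
lies in the component of parity `par + parity of j`. -/
def VecParity {p q : ℕ} (par : ZMod 2)
    (u : Fin p ⊕ Fin q → ExteriorAlgebra ℝ V) : Prop :=
  ∀ j, u j ∈ CliffordAlgebra.evenOdd (0 : QuadraticForm ℝ V) (par + parIdx j)

theorem Derivation.leibniz_finset_prod {k R ι : Type*} [CommRing k] [CommRing R] [Algebra k R]
    [DecidableEq ι] (D : Derivation k R R) (s : Finset ι) (f : ι → R) :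
    D (∏ i ∈ s, f i) = ∑ i ∈ s, ∏ j ∈ s, Function.update f i (D (f i)) j := by
  induction s using Finset.induction_on with
  | empty => simp
  | insert a s ha ih =>
    have hprod : ∏ j ∈ s, Function.update f a (D (f a)) j = ∏ j ∈ s, f j :=
      Finset.prod_congr rfl fun j hj =>
        Function.update_of_ne (fun h : j = a => ha (h ▸ hj)) _ _
    have hsum : ∀ i ∈ s, ∏ j ∈ insert a s, Function.update f i (D (f i)) j
        = f a * ∏ j ∈ s, Function.update f i (D (f i)) j := fun i hi => by
      rw [Finset.prod_insert ha, Function.update_of_ne (fun h : a = i => ha (h ▸ hi))]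
    rw [Finset.prod_insert ha, D.leibniz, ih, Finset.sum_insert ha, Finset.sum_congr rfl hsum,
      Finset.prod_insert ha, Function.update_self, hprod, ← Finset.mul_sum]
    simp only [smul_eq_mul]
    ring

/-- Jacobi's formula. -/
theorem Derivation.map_det {k R n : Type*} [CommRing k] [CommRing R] [Algebra k R]
    [Fintype n] [DecidableEq n] (D : Derivation k R R) (M : Matrix n n R) :
    D M.det = (M.adjugate * M.map D).trace := by
  have hcol : ∀ i, (M.adjugate * M.map D) i i = (M.updateCol i fun r => D (M r i)).det :=
    fun i => by
      rw [← Matrix.cramer_apply, Matrix.cramer_eq_adjugate_mulVec]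
      rfl
  simp only [Matrix.trace, Matrix.diag_apply, hcol, Matrix.det_apply]
  rw [map_sum, Finset.sum_comm]
  refine Finset.sum_congr rfl fun σ _ => ?_
  rw [Units.smul_def, map_zsmul, D.leibniz_finset_prod, Finset.smul_sum]
  refine Finset.sum_congr rfl fun i _ => ?_
  congr 1
  refine Finset.prod_congr rfl fun j _ => ?_
  rcases eq_or_ne j i with rfl | h
  · simp
  · simp [h]

theorem Matrix.sum_det_updateRow {R n : Type*} [CommRing R] [Fintype n] [DecidableEq n]
    (M X : Matrix n n R) :
    ∑ i, (M.updateRow i fun j => X i j).det = (M.adjugate * X).trace := by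
  rw [Matrix.trace_mul_comm]
  refine Finset.sum_congr rfl fun i _ => ?_
  rw [← Matrix.cramer_transpose_apply, Matrix.cramer_eq_adjugate_mulVec,
    ← Matrix.adjugate_transpose, Matrix.diag_apply, Matrix.mul_apply, Matrix.mulVec, dotProduct]
  exact Finset.sum_congr rfl fun j _ => mul_comm _ _

theorem Matrix.adjugate_eq_det_smul_inv {R n : Type*} [CommRing R] [Fintype n] [DecidableEq n]
    {M : Matrix n n R} (hM : IsUnit M.det) : M.adjugate = M.det • M⁻¹ := by
  rw [Matrix.inv_def, smul_smul, Ring.mul_inverse_cancel _ hM, one_smul]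

open PowerSeries in
/-- The logarithmic derivative of `det (1 - tM)`. -/
theorem Matrix.derivative_coe_charpolyRev {R n : Type*} [CommRing R] [Fintype n] [DecidableEq n]
    (M : Matrix n n R) :
    derivative R (M.charpolyRev : R⟦X⟧)
      = -((M.charpolyRev : R⟦X⟧) * PowerSeries.mk fun k => (M ^ (k + 1)).trace) := by
  set P : Matrix n n R⟦X⟧ := 1 - (PowerSeries.X : R⟦X⟧) • M.map (PowerSeries.C (R := R)) with hP
  set Q : Matrix n n R⟦X⟧ := Matrix.of fun i j => PowerSeries.mk fun k => (M ^ k) i j with hQ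
  have hdet : (M.charpolyRev : R⟦X⟧) = P.det := by
    rw [Matrix.charpolyRev, ← Polynomial.coeToPowerSeries.ringHom_apply, RingHom.map_det]
    congr 1
    ext i j : 1
    by_cases h : i = j <;> simp [hP, h, PowerSeries.X_mul]
  have hPd : P.map (derivative R) = -M.map (PowerSeries.C (R := R)) := by
    ext i j : 1
    have h1 : derivative R ((1 : Matrix n n R⟦X⟧) i j) = 0 := by
      rw [Matrix.one_apply]; split_ifs <;> simp
    simp [hP, h1]
  have hMQ : ∀ i j, (M.map (PowerSeries.C (R := R)) * Q) i j
      = PowerSeries.mk fun k => (M ^ (k + 1)) i j := fun i j => by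
    ext k
    simp [hQ, Matrix.mul_apply, pow_succ']
  have hPQ : P * Q = 1 := by
    ext i j k
    rw [hP, Matrix.sub_mul, Matrix.one_mul, Matrix.smul_mul, Matrix.sub_apply,
      Matrix.smul_apply, hMQ, smul_eq_mul, map_sub]
    cases k with
    | zero => by_cases h : i = j <;> simp [hQ, Matrix.one_apply, h]
    | succ k =>
      rw [PowerSeries.coeff_succ_X_mul]
      by_cases h : i = j <;> simp [hQ, Matrix.one_apply, h, PowerSeries.coeff_one]
  have hadj : P.adjugate = P.det • Q := by
    rw [← Matrix.mul_one P.adjugate, ← hPQ, ← Matrix.mul_assoc, Matrix.adjugate_mul,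
      Matrix.smul_mul, Matrix.one_mul]
  rw [hdet, Derivation.map_det, hPd, hadj, Matrix.mul_neg, Matrix.trace_neg, Matrix.smul_mul,
    Matrix.trace_smul, smul_eq_mul, Matrix.trace_mul_comm]
  congr 2
  ext k
  simp [Matrix.trace, hMQ]

theorem Matrix.eval_one_charpolyRev {R n : Type*} [CommRing R] [Fintype n] [DecidableEq n]
    (M : Matrix n n R) : M.charpolyRev.eval 1 = (1 - M).det := by
  rw [Matrix.charpolyRev, ← Polynomial.coe_evalRingHom, RingHom.map_det]
  congr 1
  ext i j
  by_cases h : i = j <;> simp [h]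

theorem Matrix.det_one_sub_mul_det_one_sub_eq_one {R m n : Type*} [CommRing R]
    [IsAddTorsionFree R] [Fintype m] [DecidableEq m] [Fintype n] [DecidableEq n]
    (M : Matrix m m R) (N : Matrix n n R)
    (h : ∀ k, (M ^ (k + 1)).trace = -(N ^ (k + 1)).trace) :
    (1 - M).det * (1 - N).det = 1 := by
  have hfg : M.charpolyRev * N.charpolyRev = 1 := by
    apply Polynomial.coe_injective
    rw [Polynomial.coe_mul, Polynomial.coe_one]
    apply PowerSeries.derivative.ext
    · have htr : (PowerSeries.mk fun k => (M ^ (k + 1)).trace)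
          = -PowerSeries.mk fun k => (N ^ (k + 1)).trace := by
        ext k
        simp [h]
      rw [Derivation.leibniz, Matrix.derivative_coe_charpolyRev,
        Matrix.derivative_coe_charpolyRev, htr, PowerSeries.derivative_one]
      simp only [smul_eq_mul]
      ring
    · rw [map_mul, Polynomial.constantCoeff_coe, Polynomial.constantCoeff_coe,
        Polynomial.coeff_zero_eq_eval_zero, Polynomial.coeff_zero_eq_eval_zero]
      simp
  have := congrArg (Polynomial.eval 1) hfg
  rwa [Polynomial.eval_mul, Polynomial.eval_one, Matrix.eval_one_charpolyRev,
    Matrix.eval_one_charpolyRev] at this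

section Supercommutative

variable {Z L m n o : Type*} [CommRing Z] [Ring L] [Algebra Z L]

/-- `O` consists of elements that anticommute pairwise and have scalar pairwise products, as
does the odd part of a supercommutative algebra. -/
structure IsOddSubmodule (O : Submodule Z L) : Prop where
  anticomm : ∀ x ∈ O, ∀ y ∈ O, x * y = -(y * x)
  mul_mem_range : ∀ x ∈ O, ∀ y ∈ O, x * y ∈ (algebraMap Z L).range

theorem exists_map_algebraMap_eq {X : Matrix m n L}
    (hX : ∀ i j, X i j ∈ (algebraMap Z L).range) :
    ∃ M : Matrix m n Z, M.map (algebraMap Z L) = X := by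
  choose M hM using hX
  exact ⟨M, by ext i j; exact hM i j⟩

theorem Ring.inverse_eq_of_mul_eq_one {M : Type*} [MonoidWithZero M] {x y : M}
    (hxy : x * y = 1) (hyx : y * x = 1) : Ring.inverse x = y :=
  Ring.inverse_unit ⟨x, y, hxy, hyx⟩

theorem RingHom.inverse_map_of_isUnit {R S : Type*} [Semiring R] [Semiring S] (f : R →+* S) {z : R}
    (hz : IsUnit z) : Ring.inverse (f z) = f (Ring.inverse z) :=
  Ring.inverse_eq_of_mul_eq_one
    (by rw [← map_mul, Ring.mul_inverse_cancel _ hz, map_one])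
    (by rw [← map_mul, Ring.inverse_mul_cancel _ hz, map_one])

theorem Matrix.map_mul_map_inv {R : Type*} [CommRing R] [Fintype n] [DecidableEq n]
    (f : R →+* L) {M : Matrix n n R} (hM : IsUnit M.det) : M.map f * M⁻¹.map f = 1 := by
  rw [← Matrix.map_mul, Matrix.mul_nonsing_inv _ hM, Matrix.map_one _ (map_zero f) (map_one f)]

theorem Matrix.map_inv_mul_map {R : Type*} [CommRing R] [Fintype n] [DecidableEq n]
    (f : R →+* L) {M : Matrix n n R} (hM : IsUnit M.det) : M⁻¹.map f * M.map f = 1 := by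
  rw [← Matrix.map_mul, Matrix.nonsing_inv_mul _ hM, Matrix.map_one _ (map_zero f) (map_one f)]

theorem Matrix.ringInverse_map {R : Type*} [CommRing R] [Fintype n] [DecidableEq n]
    (f : R →+* L) {M : Matrix n n R} (hM : IsUnit M.det) :
    Ring.inverse (M.map f) = M⁻¹.map f :=
  Ring.inverse_eq_of_mul_eq_one (Matrix.map_mul_map_inv f hM) (Matrix.map_inv_mul_map f hM)

theorem Matrix.map_mul_of_leibniz [Fintype n] (δ : L →+ L)
    (hδ : ∀ x y, δ (x * y) = δ x * y + x * δ y) (X : Matrix m n L) (Y : Matrix n o L) :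
    (X * Y).map δ = X.map δ * Y + X * Y.map δ := by
  ext i j
  simp [Matrix.mul_apply, hδ, Finset.sum_add_distrib]

theorem Matrix.map_inv_of_leibniz [Fintype n] [DecidableEq n] (δ : L →+ L)
    (hδ : ∀ x y, δ (x * y) = δ x * y + x * δ y) {X Y : Matrix n n L}
    (hXY : X * Y = 1) (hYX : Y * X = 1) :
    Y.map δ = -(Y * X.map δ * Y) := by
  have hone : δ 1 = 0 := by simpa using hδ 1 1
  have hzero : (1 : Matrix n n L).map δ = 0 := by
    ext i j
    by_cases h : i = j <;> simp [h, hone]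
  have h := congrArg (fun W => Y * W.map δ) hXY
  simp only [Matrix.map_mul_of_leibniz δ hδ, hzero, Matrix.mul_zero, Matrix.mul_add] at h
  rw [← Matrix.mul_assoc, ← Matrix.mul_assoc, hYX, Matrix.one_mul] at h
  exact eq_neg_of_add_eq_zero_right h

theorem Matrix.mul_map_algebraMap_mem [Fintype n] {O : Submodule Z L} {X : Matrix m n L}
    (hX : ∀ i j, X i j ∈ O) (M : Matrix n o Z) (i : m) (j : o) :
    (X * M.map (algebraMap Z L)) i j ∈ O :=
  Submodule.sum_mem _ fun l _ => by
    have h : M l j • X i l = X i l * algebraMap Z L (M l j) := by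
      rw [Algebra.smul_def, Algebra.commutes]
    exact h ▸ O.smul_mem _ (hX i l)

theorem Matrix.map_algebraMap_mul_mem [Fintype n] {O : Submodule Z L} {X : Matrix n o L}
    (hX : ∀ i j, X i j ∈ O) (M : Matrix m n Z) (i : m) (j : o) :
    (M.map (algebraMap Z L) * X) i j ∈ O :=
  Submodule.sum_mem _ fun l _ =>
    Algebra.smul_def (M i l) (X l j) ▸ O.smul_mem (M i l) (hX l j)

namespace IsOddSubmodule

variable {O : Submodule Z L} (hO : IsOddSubmodule O)
include hO

theorem matrix_mul_mem_range [Fintype n] {X : Matrix m n L} {Y : Matrix n o L}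
    (hX : ∀ i j, X i j ∈ O) (hY : ∀ i j, Y i j ∈ O) (i : m) (j : o) :
    (X * Y) i j ∈ (algebraMap Z L).range :=
  sum_mem fun l _ => hO.mul_mem_range _ (hX i l) _ (hY l j)

theorem trace_mul_comm [Fintype m] [Fintype n] {X : Matrix m n L} {Y : Matrix n m L}
    (hX : ∀ i j, X i j ∈ O) (hY : ∀ i j, Y i j ∈ O) :
    (X * Y).trace = -(Y * X).trace := by
  simp only [Matrix.trace, Matrix.diag_apply, Matrix.mul_apply]
  rw [Finset.sum_comm, ← Finset.sum_neg_distrib]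
  refine Finset.sum_congr rfl fun i _ => ?_
  rw [← Finset.sum_neg_distrib]
  exact Finset.sum_congr rfl fun j _ => hO.anticomm _ (hX j i) _ (hY i j)

variable [Fintype m] [DecidableEq m] [Fintype n] [DecidableEq n]

omit hO [DecidableEq m] in
theorem _root_.Matrix.trace_map_algebraMap (M : Matrix m m Z) :
    (M.map (algebraMap Z L)).trace = algebraMap Z L M.trace := by
  simp [Matrix.trace]

theorem det_one_sub_mul_det_one_sub [IsAddTorsionFree Z] [FaithfulSMul Z L]
    {B : Matrix m n L} {C : Matrix n m L} (hB : ∀ i j, B i j ∈ O) (hC : ∀ i j, C i j ∈ O)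
    {M : Matrix m m Z} {N : Matrix n n Z}
    (hM : M.map (algebraMap Z L) = B * C) (hN : N.map (algebraMap Z L) = C * B) :
    (1 - M).det * (1 - N).det = 1 := by
  have hpow : ∀ j, B * (N ^ j).map (algebraMap Z L) * C
      = (M ^ (j + 1)).map (algebraMap Z L) := fun j => by
    induction j with
    | zero =>
      rw [pow_zero, Matrix.map_one _ (map_zero _) (map_one _), Matrix.mul_one, zero_add, pow_one, hM]
    | succ j ih =>
      rw [pow_succ' N, pow_succ' M (j + 1), Matrix.map_mul, Matrix.map_mul, ← ih, hM, hN]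
      simp only [Matrix.mul_assoc]
  refine Matrix.det_one_sub_mul_det_one_sub_eq_one M N fun j =>
    (FaithfulSMul.algebraMap_injective Z L) ?_
  rw [map_neg, ← Matrix.trace_map_algebraMap, ← Matrix.trace_map_algebraMap, ← hpow,
    hO.trace_mul_comm (Matrix.mul_map_algebraMap_mem hB _) hC, ← Matrix.mul_assoc, ← hN,
    ← Matrix.map_mul, ← pow_succ']

section Schur

variable {a S : Matrix m m Z} {d T : Matrix n n Z}
  {b : Matrix m n L} {c : Matrix n m L} (hb : ∀ i j, b i j ∈ O) (hc : ∀ i j, c i j ∈ O)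
  (ha : IsUnit a.det) (hd : IsUnit d.det)
  (hS : S.map (algebraMap Z L)
    = a.map (algebraMap Z L) - b * d⁻¹.map (algebraMap Z L) * c)
  (hT : T.map (algebraMap Z L)
    = d.map (algebraMap Z L) - c * a⁻¹.map (algebraMap Z L) * b)
include hb hc ha hd hS hT

/-- The two Schur complements of a supermatrix have mutually inverse relative determinants. -/
theorem det_schur_mul_det_schur [IsAddTorsionFree Z] [FaithfulSMul Z L] :
    S.det * T.det = a.det * d.det := by
  have hB := Matrix.map_algebraMap_mul_mem hb a⁻¹
  have hC := Matrix.map_algebraMap_mul_mem hc d⁻¹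
  obtain ⟨M, hM⟩ := exists_map_algebraMap_eq (hO.matrix_mul_mem_range hB hC)
  obtain ⟨N, hN⟩ := exists_map_algebraMap_eq (hO.matrix_mul_mem_range hC hB)
  have hSM : S = a * (1 - M) := by
    refine Matrix.map_injective (FaithfulSMul.algebraMap_injective Z L) ?_
    beta_reduce
    rw [hS, Matrix.mul_sub, Matrix.mul_one, Matrix.map_sub _ (map_sub _), Matrix.map_mul, hM]
    simp only [← Matrix.mul_assoc]
    rw [Matrix.map_mul_map_inv _ ha, Matrix.one_mul]
  have hTN : T = d * (1 - N) := by
    refine Matrix.map_injective (FaithfulSMul.algebraMap_injective Z L) ?_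
    beta_reduce
    rw [hT, Matrix.mul_sub, Matrix.mul_one, Matrix.map_sub _ (map_sub _), Matrix.map_mul, hN]
    simp only [← Matrix.mul_assoc]
    rw [Matrix.map_mul_map_inv _ hd, Matrix.one_mul]
  have h := hO.det_one_sub_mul_det_one_sub hB hC hM hN
  rw [hSM, hTN, Matrix.det_mul, Matrix.det_mul]
  rw [mul_mul_mul_comm, h, mul_one]

/-- The trace form of the differentiation formula for the Berezinian. -/
theorem trace_schur_derivation [FaithfulSMul Z L] (hSu : IsUnit S.det) (hTu : IsUnit T.det)
    (δ : L →+ L) (hδ : ∀ x y, δ (x * y) = δ x * y + x * δ y)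
    (D : Derivation ℤ Z Z)
    (hD : ∀ z, δ (algebraMap Z L z) = algebraMap Z L (D z)) (hδc : ∀ i j, δ (c i j) ∈ O)
    {X : Matrix m m Z} {Y : Matrix n n Z}
    (hX : X.map (algebraMap Z L) = (a.map (algebraMap Z L)).map δ
      - b.map δ * d⁻¹.map (algebraMap Z L) * c)
    (hY : Y.map (algebraMap Z L) = (d.map (algebraMap Z L)).map δ
      - c.map δ * a⁻¹.map (algebraMap Z L) * b) :
    (S⁻¹ * S.map D).trace - (d⁻¹ * d.map D).trace
      = (S⁻¹ * X).trace - (T⁻¹ * Y).trace := by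
  apply FaithfulSMul.algebraMap_injective Z L
  rw [map_sub, map_sub, ← Matrix.trace_map_algebraMap, ← Matrix.trace_map_algebraMap,
    ← Matrix.trace_map_algebraMap, ← Matrix.trace_map_algebraMap, Matrix.map_mul, Matrix.map_mul,
    Matrix.map_mul, Matrix.map_mul, hX, hY]
  have hSδ : (S.map D).map (algebraMap Z L)
      = (S.map (algebraMap Z L)).map δ := by
    ext i j
    exact (hD _).symm
  obtain ⟨d', hd'⟩ : ∃ d', d' = d.map D := ⟨_, rfl⟩
  have hdδ : (d.map (algebraMap Z L)).map δ = d'.map (algebraMap Z L) := by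
    ext i j
    exact hd' ▸ hD _
  rw [hSδ, ← hd', hdδ]
  have hdiδ := Matrix.map_inv_of_leibniz δ hδ (Matrix.map_mul_map_inv (algebraMap Z L) hd)
    (Matrix.map_inv_mul_map (algebraMap Z L) hd)
  rw [hdδ] at hdiδ
  have hSmap : (S.map (algebraMap Z L)).map δ
      = (a.map (algebraMap Z L)).map δ - b.map δ * d⁻¹.map (algebraMap Z L) * c
        + b * d⁻¹.map (algebraMap Z L) * d'.map (algebraMap Z L) * d⁻¹.map (algebraMap Z L) * c
        - b * d⁻¹.map (algebraMap Z L) * c.map δ := by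
    rw [hS, Matrix.map_sub _ (map_sub _), Matrix.map_mul_of_leibniz δ hδ,
      Matrix.map_mul_of_leibniz δ hδ, hdiδ]
    simp only [Matrix.mul_neg, Matrix.add_mul, Matrix.neg_mul, ← Matrix.mul_assoc]
    abel
  have hSi := Matrix.map_inv_mul_map (algebraMap Z L) hSu
  have hTi := Matrix.map_mul_map_inv (algebraMap Z L) hTu
  have hdi' := Matrix.map_inv_mul_map (algebraMap Z L) hd
  have hai := Matrix.map_mul_map_inv (algebraMap Z L) ha
  have hcross : S⁻¹.map (algebraMap Z L) * b * d⁻¹.map (algebraMap Z L)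
      = a⁻¹.map (algebraMap Z L) * b * T⁻¹.map (algebraMap Z L) := by
    have h : S.map (algebraMap Z L) * (a⁻¹.map (algebraMap Z L) * b)
        = b * d⁻¹.map (algebraMap Z L) * T.map (algebraMap Z L) := by
      rw [hS, hT, Matrix.sub_mul, Matrix.mul_sub, ← Matrix.mul_assoc, hai, Matrix.one_mul,
        Matrix.mul_assoc b (d⁻¹.map _) (d.map _), hdi', Matrix.mul_one]
      simp only [Matrix.mul_assoc]
    calc _ = S⁻¹.map (algebraMap Z L) * (b * d⁻¹.map (algebraMap Z L) * T.map (algebraMap Z L))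
          * T⁻¹.map (algebraMap Z L) := by
            simp only [Matrix.mul_assoc, hTi, Matrix.mul_one]
      _ = _ := by
            rw [← h, ← Matrix.mul_assoc, hSi, Matrix.one_mul]
  have hTinv : T⁻¹.map (algebraMap Z L) = d⁻¹.map (algebraMap Z L)
      + d⁻¹.map (algebraMap Z L) * c * S⁻¹.map (algebraMap Z L) * b * d⁻¹.map (algebraMap Z L) := by
    have h : c * (a⁻¹.map (algebraMap Z L) * b)
        = d.map (algebraMap Z L) - T.map (algebraMap Z L) := by
      rw [hT, sub_sub_cancel, Matrix.mul_assoc]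
    have hassoc : d⁻¹.map (algebraMap Z L) * c * S⁻¹.map (algebraMap Z L) * b
          * d⁻¹.map (algebraMap Z L)
        = d⁻¹.map (algebraMap Z L) * (c * (S⁻¹.map (algebraMap Z L) * b
          * d⁻¹.map (algebraMap Z L))) := by
      simp only [Matrix.mul_assoc]
    rw [hassoc, hcross, ← Matrix.mul_assoc c, h, Matrix.sub_mul, hTi, Matrix.mul_sub,
      Matrix.mul_one, ← Matrix.mul_assoc, hdi', Matrix.one_mul, add_sub_cancel]
  have hcyc₁ : (d⁻¹.map (algebraMap Z L) * c * (S⁻¹.map (algebraMap Z L) * b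
        * d⁻¹.map (algebraMap Z L) * d'.map (algebraMap Z L))).trace
      = -(S⁻¹.map (algebraMap Z L) * b * d⁻¹.map (algebraMap Z L) * d'.map (algebraMap Z L)
        * (d⁻¹.map (algebraMap Z L) * c)).trace :=
    hO.trace_mul_comm (Matrix.map_algebraMap_mul_mem hc _)
      (Matrix.mul_map_algebraMap_mem (Matrix.mul_map_algebraMap_mem
        (Matrix.map_algebraMap_mul_mem hb _) _) _)
  have hcyc₂ : (T⁻¹.map (algebraMap Z L) * c.map δ * (a⁻¹.map (algebraMap Z L) * b)).trace
      = -(a⁻¹.map (algebraMap Z L) * b * (T⁻¹.map (algebraMap Z L) * c.map δ)).trace :=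
    hO.trace_mul_comm (Matrix.map_algebraMap_mul_mem hδc _) (Matrix.map_algebraMap_mul_mem hb _)
  have hleft : (S⁻¹.map (algebraMap Z L) * (S.map (algebraMap Z L)).map δ).trace
      = (S⁻¹.map (algebraMap Z L) * ((a.map (algebraMap Z L)).map δ
          - b.map δ * d⁻¹.map (algebraMap Z L) * c)).trace
        + (S⁻¹.map (algebraMap Z L) * b * d⁻¹.map (algebraMap Z L) * d'.map (algebraMap Z L)
          * (d⁻¹.map (algebraMap Z L) * c)).trace
        - (a⁻¹.map (algebraMap Z L) * b * (T⁻¹.map (algebraMap Z L) * c.map δ)).trace := by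
    rw [← Matrix.mul_assoc (a⁻¹.map (algebraMap Z L) * b), ← hcross, hSmap, ← Matrix.trace_add,
      ← Matrix.trace_sub]
    congr 1
    simp only [Matrix.mul_add, Matrix.mul_sub, Matrix.mul_assoc]
  have hright : (T⁻¹.map (algebraMap Z L) * (d'.map (algebraMap Z L)
        - c.map δ * a⁻¹.map (algebraMap Z L) * b)).trace
      = (d⁻¹.map (algebraMap Z L) * d'.map (algebraMap Z L)).trace
        + (d⁻¹.map (algebraMap Z L) * c * (S⁻¹.map (algebraMap Z L) * b
          * d⁻¹.map (algebraMap Z L) * d'.map (algebraMap Z L))).trace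
        - (T⁻¹.map (algebraMap Z L) * c.map δ * (a⁻¹.map (algebraMap Z L) * b)).trace := by
    rw [Matrix.mul_sub, Matrix.trace_sub, ← Matrix.trace_add]
    congr 2
    · rw [hTinv]
      simp only [Matrix.add_mul, Matrix.mul_assoc]
    · simp only [Matrix.mul_assoc]
  rw [hleft, hright, hcyc₁, hcyc₂]
  abel

/-- The differentiation formula for the Berezinian, in terms of Schur complements. -/
theorem derivation_det_schur_mul_inverse [IsAddTorsionFree Z] [FaithfulSMul Z L]
    (δ : L →+ L) (hδ : ∀ x y, δ (x * y) = δ x * y + x * δ y) (D : Derivation ℤ Z Z)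
    (hD : ∀ z, δ (algebraMap Z L z) = algebraMap Z L (D z)) (hδc : ∀ i j, δ (c i j) ∈ O)
    {X : Matrix m m Z} {Y : Matrix n n Z}
    (hX : X.map (algebraMap Z L) = (a.map (algebraMap Z L)).map δ
      - b.map δ * d⁻¹.map (algebraMap Z L) * c)
    (hY : Y.map (algebraMap Z L) = (d.map (algebraMap Z L)).map δ
      - c.map δ * a⁻¹.map (algebraMap Z L) * b) :
    D (S.det * Ring.inverse d.det)
      = (∑ i, (S.updateRow i fun j => X i j).det * Ring.inverse d.det)
        - (S.det * Ring.inverse d.det) ^ 2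
          * ∑ i, (T.updateRow i fun j => Y i j).det * Ring.inverse a.det := by
  have hST := hO.det_schur_mul_det_schur hb hc ha hd hS hT
  have hSTu : IsUnit (S.det * T.det) := hST ▸ ha.mul hd
  have hSu := isUnit_of_mul_isUnit_left hSTu
  have hTu := isUnit_of_mul_isUnit_right hSTu
  have htr := hO.trace_schur_derivation hb hc ha hd hS hT hSu hTu δ hδ D hD hδc hX hY
  have hinva := Ring.mul_inverse_cancel _ ha
  have hinvd := Ring.mul_inverse_cancel _ hd
  have hDinv := D.leibniz_of_mul_eq_one (Ring.inverse_mul_cancel _ hd)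
  rw [← Finset.sum_mul, ← Finset.sum_mul, Matrix.sum_det_updateRow, Matrix.sum_det_updateRow,
    D.leibniz, hDinv, D.map_det, D.map_det, Matrix.adjugate_eq_det_smul_inv hSu,
    Matrix.adjugate_eq_det_smul_inv hTu, Matrix.adjugate_eq_det_smul_inv hd]
  simp only [Matrix.smul_mul, Matrix.trace_smul, smul_eq_mul]
  set u := Ring.inverse d.det
  set v := Ring.inverse a.det
  set t₁ := (S⁻¹ * S.map D).trace
  set t₂ := (d⁻¹ * d.map D).trace
  set t₃ := (S⁻¹ * X).trace
  set t₄ := (T⁻¹ * Y).trace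
  have hone : S.det * T.det * u * v = 1 := by
    rw [hST]
    linear_combination a.det * v * hinvd + hinva
  linear_combination S.det * u * htr - S.det * u * t₂ * hinvd + S.det * u * t₄ * hone

end Schur
end IsOddSubmodule
end Supercommutative

section Center

variable {L m n : Type*} [Ring L]

theorem isUnit_of_isUnit_algebraMap_center {z : Subring.center L}
    (hz : IsUnit (algebraMap (Subring.center L) L z)) : IsUnit z := by
  obtain ⟨u, hu⟩ := hz
  have hinv : (↑u⁻¹ : L) ∈ Subring.center L := Subring.mem_center_iff.2 fun y => by
    have h : Commute y (u : L) := by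
      rw [hu]
      exact Subring.mem_center_iff.1 z.2 y
    exact h.units_inv_right
  refine IsUnit.of_mul_eq_one ⟨_, hinv⟩ (Subtype.ext ?_)
  change algebraMap (Subring.center L) L z * ↑u⁻¹ = 1
  rw [← hu, Units.mul_inv]

/-- Restriction of a derivation of a ring to its center. -/
def centerDerivation (δ : L →+ L) (hδ : ∀ x y, δ (x * y) = δ x * y + x * δ y) :
    Derivation ℤ (Subring.center L) (Subring.center L) :=
  Derivation.mk'
    (((δ.comp (Subring.center L).subtype.toAddMonoidHom).codRestrict
      (Subring.center L).toAddSubgroup fun x => by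
        change δ x ∈ Subring.center L
        refine Subring.mem_center_iff.2 fun y => ?_
        have hx := Subring.mem_center_iff.1 x.2
        have h := congrArg δ (hx y)
        rw [hδ, hδ, hx (δ y), add_comm] at h
        exact add_right_cancel h : Subring.center L →+ Subring.center L).toIntLinearMap)
    fun x y => Subtype.ext <| by
      have hx : δ x * y = y * δ x := Subring.mem_center_iff.1 y.2 _
      change δ (x * y) = x * δ y + y * δ x
      rw [hδ, hx, add_comm]

end Center

theorem IsAddTorsionFree.of_module_real (M : Type*) [AddCommGroup M] [Module ℝ M] :
    IsAddTorsionFree M :=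
  letI := Module.compHom M (algebraMap ℚ ℝ)
  .of_module_rat M

theorem Matrix.updateRow_sub_updateRow_mul {R l m n : Type*} [Ring R] [DecidableEq l] [Fintype m]
    (a : Matrix l n R) (b : Matrix l m R) (K : Matrix m n R) (a' : Matrix l n R)
    (b' : Matrix l m R) (i : l) :
    a.updateRow i (fun j => a' i j) - b.updateRow i (fun j => b' i j) * K
      = (a - b * K).updateRow i fun j => (a' - b' * K) i j := by
  ext r s
  rcases eq_or_ne r i with rfl | h
  · simp [Matrix.mul_apply]
  · simp [Matrix.mul_apply, h]

namespace ExteriorAlgebra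

theorem ι_mul_ι_swap (v w : V) : ι ℝ v * ι ℝ w = -(ι ℝ w * ι ℝ v) :=
  eq_neg_of_add_eq_zero_left (ι_add_mul_swap v w)

theorem commute_ι_of_mem_even {x : ExteriorAlgebra ℝ V} (hx : x ∈ Λ₀ V) (v : V) :
    Commute (ι ℝ v) x := by
  refine CliffordAlgebra.even_induction (0 : QuadraticForm ℝ V)
    (motive := fun x _ => Commute (ι ℝ v) x) ?_ ?_ ?_ x hx
  · exact fun r => (Algebra.commutes r _).symm
  · exact fun x y _ _ h₁ h₂ => h₁.add_right h₂
  · intro m₁ m₂ x _ h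
    refine Commute.mul_right ?_ h
    change ι ℝ v * (ι ℝ m₁ * ι ℝ m₂) = ι ℝ m₁ * ι ℝ m₂ * ι ℝ v
    rw [← mul_assoc, ι_mul_ι_swap v m₁, neg_mul, mul_assoc, ι_mul_ι_swap v m₂, mul_neg, neg_neg,
      mul_assoc]

theorem mem_center_of_mem_even {x : ExteriorAlgebra ℝ V} (hx : x ∈ Λ₀ V) :
    x ∈ Subring.center (ExteriorAlgebra ℝ V) :=
  Subring.mem_center_iff.2 fun y => by
    induction y using ExteriorAlgebra.induction with
    | algebraMap r => exact Algebra.commutes r x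
    | ι v => exact commute_ι_of_mem_even hx v
    | mul a b ha hb => exact Commute.mul_left ha hb
    | add a b ha hb => exact Commute.add_left ha hb

theorem mul_mem_even_of_mem_odd {x y : ExteriorAlgebra ℝ V} (hx : x ∈ Λ₁ V) (hy : y ∈ Λ₁ V) :
    x * y ∈ Λ₀ V := by
  have h := SetLike.mul_mem_graded (A := CliffordAlgebra.evenOdd (0 : QuadraticForm ℝ V)) hx hy
  exact h

theorem ι_mul_of_mem_odd {x : ExteriorAlgebra ℝ V} (hx : x ∈ Λ₁ V) (v : V) :
    ι ℝ v * x = -(x * ι ℝ v) := by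
  refine CliffordAlgebra.odd_induction (0 : QuadraticForm ℝ V)
    (P := fun x _ => ι ℝ v * x = -(x * ι ℝ v)) ?_ ?_ ?_ x hx
  · exact fun w => ι_mul_ι_swap v w
  · intro x y _ _ h₁ h₂
    rw [mul_add, add_mul, h₁, h₂, neg_add]
  · intro m₁ m₂ x _ h
    have hc := commute_ι_of_mem_even
      (CliffordAlgebra.ι_mul_ι_mem_evenOdd_zero (0 : QuadraticForm ℝ V) m₁ m₂) v
    rw [← mul_assoc, hc.eq, mul_assoc, h, mul_neg, ← mul_assoc]

theorem mul_of_mem_odd {x y : ExteriorAlgebra ℝ V} (hx : x ∈ Λ₁ V) (hy : y ∈ Λ₁ V) :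
    x * y = -(y * x) := by
  refine CliffordAlgebra.odd_induction (0 : QuadraticForm ℝ V)
    (P := fun x _ => x * y = -(y * x)) ?_ ?_ ?_ x hx
  · exact fun v => ι_mul_of_mem_odd hy v
  · intro x x' _ _ h₁ h₂
    rw [mul_add, add_mul, h₁, h₂, neg_add]
  · intro m₁ m₂ x _ h
    have hc := Subring.mem_center_iff.1 (mem_center_of_mem_even
      (CliffordAlgebra.ι_mul_ι_mem_evenOdd_zero (0 : QuadraticForm ℝ V) m₁ m₂)) y
    rw [mul_assoc, h, mul_neg, ← mul_assoc, ← hc, mul_assoc]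

theorem isOddSubmodule_span_odd :
    IsOddSubmodule (Submodule.span (Subring.center (ExteriorAlgebra ℝ V))
      (Λ₁ V : Set (ExteriorAlgebra ℝ V))) where
  anticomm x hx y hy := by
    induction hx, hy using Submodule.span_induction₂ with
    | mem_mem x y hx hy => exact mul_of_mem_odd hx hy
    | zero_left => simp
    | zero_right => simp
    | add_left x y z _ _ _ h₁ h₂ => rw [add_mul, mul_add, h₁, h₂, neg_add]
    | add_right x y z _ _ _ h₁ h₂ => rw [add_mul, mul_add, h₁, h₂, neg_add]
    | smul_left r x y _ _ h => rw [smul_mul_assoc, mul_smul_comm, h, smul_neg]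
    | smul_right r x y _ _ h => rw [smul_mul_assoc, mul_smul_comm, h, smul_neg]
  mul_mem_range x hx y hy := by
    induction hx, hy using Submodule.span_induction₂ with
    | mem_mem x y hx hy =>
      exact ⟨⟨x * y, mem_center_of_mem_even (mul_mem_even_of_mem_odd hx hy)⟩, rfl⟩
    | zero_left => simp
    | zero_right => simp
    | add_left x y z _ _ _ h₁ h₂ => exact add_mul x y z ▸ add_mem h₁ h₂
    | add_right x y z _ _ _ h₁ h₂ => exact mul_add x y z ▸ add_mem h₁ h₂
    | smul_left r x y _ _ h =>
      rw [smul_mul_assoc, Algebra.smul_def]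
      exact mul_mem ⟨r, rfl⟩ h
    | smul_right r x y _ _ h =>
      rw [mul_smul_comm, Algebra.smul_def]
      exact mul_mem ⟨r, rfl⟩ h

end ExteriorAlgebra

theorem ncdet_map_algebraMap {Z : Type*} [CommRing Z] [Algebra Z (ExteriorAlgebra ℝ V)] {n : ℕ}
    (M : Matrix (Fin n) (Fin n) Z) :
    ncdet (M.map (algebraMap Z (ExteriorAlgebra ℝ V)))
      = algebraMap Z (ExteriorAlgebra ℝ V) M.det := by
  rw [ncdet, Matrix.det_apply, map_sum]
  refine Finset.sum_congr rfl fun σ _ => ?_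
  rw [Units.smul_def, map_zsmul, ← List.prod_ofFn, map_list_prod, List.map_ofFn]
  rfl

theorem ncdet_mul_inverse_ncdet {Z : Type*} [CommRing Z] [Algebra Z (ExteriorAlgebra ℝ V)]
    {p q : ℕ} {S : Matrix (Fin p) (Fin p) Z} {d : Matrix (Fin q) (Fin q) Z}
    (hd : IsUnit d.det) :
    ncdet (S.map (algebraMap Z (ExteriorAlgebra ℝ V)))
        * Ring.inverse (ncdet (d.map (algebraMap Z (ExteriorAlgebra ℝ V))))
      = algebraMap Z (ExteriorAlgebra ℝ V) (S.det * Ring.inverse d.det) := by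
  rw [ncdet_map_algebraMap, ncdet_map_algebraMap, RingHom.inverse_map_of_isUnit _ hd, map_mul]

theorem Ber_updateRow_inl {p q : ℕ}
    (A : Matrix (Fin p ⊕ Fin q) (Fin p ⊕ Fin q) (ExteriorAlgebra ℝ V))
    (δ : ExteriorAlgebra ℝ V → ExteriorAlgebra ℝ V) (i : Fin p) :
    Ber (A.updateRow (Sum.inl i) fun j => δ (A (Sum.inl i) j))
      = ncdet ((A.toBlocks₁₁ - A.toBlocks₁₂ * Ring.inverse A.toBlocks₂₂ * A.toBlocks₂₁).updateRow i
          fun j => (A.toBlocks₁₁.map δ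
            - A.toBlocks₁₂.map δ * Ring.inverse A.toBlocks₂₂ * A.toBlocks₂₁) i j)
        * Ring.inverse (ncdet A.toBlocks₂₂) := by
  have h₁₁ : (A.updateRow (Sum.inl i) fun j => δ (A (Sum.inl i) j)).toBlocks₁₁
      = A.toBlocks₁₁.updateRow i fun j => A.toBlocks₁₁.map δ i j := by
    ext r s
    rcases eq_or_ne r i with rfl | h <;> simp [Matrix.toBlocks₁₁, *]
  have h₁₂ : (A.updateRow (Sum.inl i) fun j => δ (A (Sum.inl i) j)).toBlocks₁₂
      = A.toBlocks₁₂.updateRow i fun j => A.toBlocks₁₂.map δ i j := by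
    ext r s
    rcases eq_or_ne r i with rfl | h <;> simp [Matrix.toBlocks₁₂, *]
  have h₂₁ : (A.updateRow (Sum.inl i) fun j => δ (A (Sum.inl i) j)).toBlocks₂₁
      = A.toBlocks₂₁ := by
    ext r s
    simp [Matrix.toBlocks₂₁]
  have h₂₂ : (A.updateRow (Sum.inl i) fun j => δ (A (Sum.inl i) j)).toBlocks₂₂
      = A.toBlocks₂₂ := by
    ext r s
    simp [Matrix.toBlocks₂₂]
  rw [Ber, h₁₁, h₁₂, h₂₁, h₂₂, Matrix.mul_assoc, Matrix.updateRow_sub_updateRow_mul]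
  simp only [Matrix.mul_assoc]

theorem BerStar_updateRow_inr {p q : ℕ}
    (A : Matrix (Fin p ⊕ Fin q) (Fin p ⊕ Fin q) (ExteriorAlgebra ℝ V))
    (δ : ExteriorAlgebra ℝ V → ExteriorAlgebra ℝ V) (i : Fin q) :
    BerStar (A.updateRow (Sum.inr i) fun j => δ (A (Sum.inr i) j))
      = ncdet ((A.toBlocks₂₂ - A.toBlocks₂₁ * Ring.inverse A.toBlocks₁₁ * A.toBlocks₁₂).updateRow i
          fun j => (A.toBlocks₂₂.map δ
            - A.toBlocks₂₁.map δ * Ring.inverse A.toBlocks₁₁ * A.toBlocks₁₂) i j)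
        * Ring.inverse (ncdet A.toBlocks₁₁) := by
  have h₂₂ : (A.updateRow (Sum.inr i) fun j => δ (A (Sum.inr i) j)).toBlocks₂₂
      = A.toBlocks₂₂.updateRow i fun j => A.toBlocks₂₂.map δ i j := by
    ext r s
    rcases eq_or_ne r i with rfl | h <;> simp [Matrix.toBlocks₂₂, *]
  have h₂₁ : (A.updateRow (Sum.inr i) fun j => δ (A (Sum.inr i) j)).toBlocks₂₁
      = A.toBlocks₂₁.updateRow i fun j => A.toBlocks₂₁.map δ i j := by
    ext r s
    rcases eq_or_ne r i with rfl | h <;> simp [Matrix.toBlocks₂₁, *]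
  have h₁₂ : (A.updateRow (Sum.inr i) fun j => δ (A (Sum.inr i) j)).toBlocks₁₂
      = A.toBlocks₁₂ := by
    ext r s
    simp [Matrix.toBlocks₁₂]
  have h₁₁ : (A.updateRow (Sum.inr i) fun j => δ (A (Sum.inr i) j)).toBlocks₁₁
      = A.toBlocks₁₁ := by
    ext r s
    simp [Matrix.toBlocks₁₁]
  rw [BerStar, h₁₁, h₁₂, h₂₁, h₂₂, Matrix.mul_assoc, Matrix.updateRow_sub_updateRow_mul]
  simp only [Matrix.mul_assoc]

/-- **Row-by-row differentiation of the Berezinian**: for a grading-preserving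
derivation `δ` of `Λ`,
`δ(Ber A) = Σ_{i even} Ber(A⟨row i ← δ row i⟩) − (Ber A)² Σ_{i odd} Ber*(A⟨row i ← δ row i⟩)`. -/
theorem berezinian_derivation_row_by_row {p q : ℕ}
    (δ : ExteriorAlgebra ℝ V →ₗ[ℝ] ExteriorAlgebra ℝ V)
    (hder : ∀ x y, δ (x * y) = δ x * y + x * δ y)
    (hpar0 : ∀ x ∈ Λ₀ V, δ x ∈ Λ₀ V) (hpar1 : ∀ x ∈ Λ₁ V, δ x ∈ Λ₁ V)
    (A : Matrix (Fin p ⊕ Fin q) (Fin p ⊕ Fin q) (ExteriorAlgebra ℝ V))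
    (hA : IsEvenSupermatrix A)
    (h00 : IsUnit (ncdet A.toBlocks₁₁)) (h11 : IsUnit (ncdet A.toBlocks₂₂)) :
    δ (Ber A)
      = (∑ i : Fin p,
          Ber (A.updateRow (Sum.inl i) (fun j => δ (A (Sum.inl i) j))))
        - (Ber A) ^ 2
            * ∑ i : Fin q,
        BerStar (A.updateRow (Sum.inr i) (fun j => δ (A (Sum.inr i) j))) := by
  set Z := Subring.center (ExteriorAlgebra ℝ V)
  set φ := algebraMap Z (ExteriorAlgebra ℝ V)
  have hO := ExteriorAlgebra.isOddSubmodule_span_odd (V := V)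
  have hcen : ∀ x ∈ Λ₀ V, x ∈ φ.range := fun x hx =>
    ⟨⟨x, ExteriorAlgebra.mem_center_of_mem_even hx⟩, rfl⟩
  have hA₁₁ : ∀ i j, A.toBlocks₁₁ i j ∈ Λ₀ V := fun i j => hA (Sum.inl i) (Sum.inl j)
  have hA₂₂ : ∀ i j, A.toBlocks₂₂ i j ∈ Λ₀ V := fun i j => hA (Sum.inr i) (Sum.inr j)
  have hA₂₁ : ∀ i j, A.toBlocks₂₁ i j ∈ Λ₁ V := fun i j => hA (Sum.inr i) (Sum.inl j)
  have hA₁₂ : ∀ i j, A.toBlocks₁₂ i j ∈ Λ₁ V := fun i j => hA (Sum.inl i) (Sum.inr j)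
  have hb : ∀ i j, A.toBlocks₁₂ i j ∈ Submodule.span Z (Λ₁ V : Set (ExteriorAlgebra ℝ V)) :=
    fun i j => Submodule.subset_span (hA₁₂ i j)
  have hc : ∀ i j, A.toBlocks₂₁ i j ∈ Submodule.span Z (Λ₁ V : Set (ExteriorAlgebra ℝ V)) :=
    fun i j => Submodule.subset_span (hA₂₁ i j)
  have hδb : ∀ i j, A.toBlocks₁₂.map δ i j ∈
      Submodule.span Z (Λ₁ V : Set (ExteriorAlgebra ℝ V)) :=
    fun i j => Submodule.subset_span (hpar1 _ (hA₁₂ i j))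
  have hδc : ∀ i j, A.toBlocks₂₁.map δ i j ∈
      Submodule.span Z (Λ₁ V : Set (ExteriorAlgebra ℝ V)) :=
    fun i j => Submodule.subset_span (hpar1 _ (hA₂₁ i j))
  obtain ⟨a, ha⟩ := exists_map_algebraMap_eq fun i j => hcen _ (hA₁₁ i j)
  obtain ⟨d, hd⟩ := exists_map_algebraMap_eq fun i j => hcen _ (hA₂₂ i j)
  rw [← ha, ncdet_map_algebraMap] at h00
  rw [← hd, ncdet_map_algebraMap] at h11
  have hau := isUnit_of_isUnit_algebraMap_center h00
  have hdu := isUnit_of_isUnit_algebraMap_center h11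
  obtain ⟨S, hS⟩ := exists_map_algebraMap_eq (Z := Z)
    (X := A.toBlocks₁₁ - A.toBlocks₁₂ * d⁻¹.map φ * A.toBlocks₂₁) fun i j =>
      sub_mem (hcen _ (hA₁₁ i j))
        (hO.matrix_mul_mem_range (Matrix.mul_map_algebraMap_mem hb _) hc i j)
  obtain ⟨T, hT⟩ := exists_map_algebraMap_eq (Z := Z)
    (X := A.toBlocks₂₂ - A.toBlocks₂₁ * a⁻¹.map φ * A.toBlocks₁₂) fun i j =>
      sub_mem (hcen _ (hA₂₂ i j))
        (hO.matrix_mul_mem_range (Matrix.mul_map_algebraMap_mem hc _) hb i j)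
  obtain ⟨X, hX⟩ := exists_map_algebraMap_eq (Z := Z)
    (X := A.toBlocks₁₁.map δ - A.toBlocks₁₂.map δ * d⁻¹.map φ * A.toBlocks₂₁) fun i j =>
      sub_mem (hcen _ (hpar0 _ (hA₁₁ i j)))
        (hO.matrix_mul_mem_range (Matrix.mul_map_algebraMap_mem hδb _) hc i j)
  obtain ⟨Y, hY⟩ := exists_map_algebraMap_eq (Z := Z)
    (X := A.toBlocks₂₂.map δ - A.toBlocks₂₁.map δ * a⁻¹.map φ * A.toBlocks₁₂) fun i j =>
      sub_mem (hcen _ (hpar0 _ (hA₂₂ i j)))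
        (hO.matrix_mul_mem_range (Matrix.mul_map_algebraMap_mem hδc _) hb i j)
  have hinva : Ring.inverse A.toBlocks₁₁ = a⁻¹.map φ := by
    rw [← ha, Matrix.ringInverse_map _ hau]
  have hinvd : Ring.inverse A.toBlocks₂₂ = d⁻¹.map φ := by
    rw [← hd, Matrix.ringInverse_map _ hdu]
  have hBer : Ber A = φ (S.det * Ring.inverse d.det) := by
    rw [Ber, hinvd, ← hS, ← hd, ncdet_mul_inverse_ncdet hdu]
  have hBer' : ∀ i, Ber (A.updateRow (Sum.inl i) fun j => δ (A (Sum.inl i) j))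
      = φ ((S.updateRow i fun j => X i j).det * Ring.inverse d.det) := fun i => by
    rw [Ber_updateRow_inl, hinvd, ← hS, ← hX, ← hd, ← ncdet_mul_inverse_ncdet hdu,
      Matrix.map_updateRow]
    rfl
  have hBerStar' : ∀ i, BerStar (A.updateRow (Sum.inr i) fun j => δ (A (Sum.inr i) j))
      = φ ((T.updateRow i fun j => Y i j).det * Ring.inverse a.det) := fun i => by
    rw [BerStar_updateRow_inr, hinva, ← hT, ← hY, ← ha, ← ncdet_mul_inverse_ncdet hau,
      Matrix.map_updateRow]
    rfl
  have : IsAddTorsionFree (ExteriorAlgebra ℝ V) := .of_module_real _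
  have : IsAddTorsionFree Z :=
    Function.Injective.isAddTorsionFree Z.subtype.toAddMonoidHom Subtype.val_injective
  rw [← ha] at hS hX
  rw [← hd] at hT hY
  have key := hO.derivation_det_schur_mul_inverse hb hc hau hdu hS hT δ.toAddMonoidHom hder
    (centerDerivation δ.toAddMonoidHom hder) (fun _ => rfl) hδc hX hY
  have hδφ : δ (Ber A) = φ (centerDerivation δ.toAddMonoidHom hder
      (S.det * Ring.inverse d.det)) := by
    rw [hBer]
    rfl
  rw [hδφ, key, hBer]
  simp only [hBer', hBerStar', map_sub, map_mul, map_pow, map_sum]
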